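/- arXiv:1708.07168 — 2 statements merged into one kernel-verified Lean document; each statement's English description precedes it below -/
import Mathlib

section
/- Let c, d ∈ ℝ with d ≠ 0 and c² + 4d ≠ 0, and let λ ∈ ℂ satisfy λ² = cλ + d (so λ is a root of the characteristic equation and λ ≠ 0). Let y, z : ℝ → ℝ be differentiable with y'(t) = c·y(t) + d·z(t) − 1 and z'(t) = y(t) for all t, and suppose z(0) = 0 and z(τ) = 0 for some τ ∈ ℝ. Then, in ℂ, exp(λτ)·(1 − λ·y(0)) = 1 − λ·y(τ). -/
/-- A solution of the scalar linear equation `u' = a u` is `u 0` times an exponential. -/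
theorem eq_exp_mul_of_hasDerivAt {a : ℂ} {u : ℝ → ℂ}
    (hu : ∀ t, HasDerivAt u (a * u t) t) (t : ℝ) :
    u t = Complex.exp (a * t) * u 0 := by
  have hg : ∀ s : ℝ, HasDerivAt (fun s : ℝ => Complex.exp (-(a * s)) * u s) 0 s := by
    intro s
    have he : HasDerivAt (fun s : ℝ => Complex.exp (-(a * s)))
        (Complex.exp (-(a * s)) * -(a * 1)) s :=
      ((Complex.ofRealCLM.hasDerivAt (x := s)).const_mul a).neg.cexp
    exact (he.mul (hu s)).congr_deriv (by ring)
  have hconst := is_const_of_deriv_eq_zero (fun s => (hg s).differentiableAt)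
    (fun s => (hg s).deriv) t 0
  simp only [Complex.ofReal_zero, mul_zero, neg_zero, Complex.exp_zero, one_mul] at hconst
  rw [← hconst, ← mul_assoc, ← Complex.exp_add, add_neg_cancel, Complex.exp_zero, one_mul]

/-- Boundary-value identity for the planar system `y' = cy + dz - 1`, `z' = y`:
if `λ` is a (nonzero) root of `λ² = cλ + d` and `z(0) = z(τ) = 0`, then
`exp(λτ)(1 - λ y(0)) = 1 - λ y(τ)` in `ℂ`. -/
theorem stmt_9 (c d : ℝ) (hd : d ≠ 0) (hdisc : c ^ 2 + 4 * d ≠ 0)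
    (lam : ℂ) (hlam : lam ^ 2 = (c : ℂ) * lam + (d : ℂ))
    (y z : ℝ → ℝ)
    (hy : ∀ t, HasDerivAt y (c * y t + d * z t - 1) t)
    (hz : ∀ t, HasDerivAt z (y t) t)
    (τ : ℝ) (hz0 : z 0 = 0) (hzτ : z τ = 0) :
    Complex.exp (lam * τ) * (1 - lam * (y 0 : ℂ)) = 1 - lam * (y τ : ℂ) := by
  have hu : ∀ t, HasDerivAt (fun t => 1 - (lam * (y t : ℂ) + d * (z t : ℂ)))
      (lam * (1 - (lam * (y t : ℂ) + d * (z t : ℂ)))) t := by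
    intro t
    refine ((((hy t).ofReal_comp.const_mul lam).add
      ((hz t).ofReal_comp.const_mul (d : ℂ))).const_sub 1).congr_deriv ?_
    push_cast
    linear_combination (y t : ℂ) * hlam
  have h := eq_exp_mul_of_hasDerivAt hu τ
  simpa [hz0, hzτ] using h.symm
end

section
/- Let c ∈ ℝ, c ≠ 0, and let y, z : ℝ → ℝ be differentiable with y'(t) = c·y(t) − 1 and z'(t) = y(t) for all t, and suppose z(0) = 0 and z(τ) = 0 for some τ ∈ ℝ. Writing y₀ = y(0) and y₁ = y(τ), one has τ = y₀ − y₁ and e^{cτ}·(c·y₀ − 1) = c·y₁ − 1. -/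
/-- A real function whose derivative vanishes everywhere takes equal values at any two points. -/
theorem eq_of_hasDerivAt_zero {f : ℝ → ℝ} (hf : ∀ t, HasDerivAt f 0 t) (a b : ℝ) : f a = f b :=
  is_const_of_deriv_eq_zero (fun t => (hf t).differentiableAt) (fun t => (hf t).deriv) a b

/-- Boundary-value relations for the degenerate case `D₁`: for the system
`y' = cy - 1`, `z' = y` with `c ≠ 0` and `z(0) = z(τ) = 0`, one has
`τ = y₀ - y₁` and `e^{cτ}(cy₀ - 1) = cy₁ - 1`. -/
theorem stmt_12 (c : ℝ) (hc : c ≠ 0)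
    (y z : ℝ → ℝ)
    (hy : ∀ t, HasDerivAt y (c * y t - 1) t)
    (hz : ∀ t, HasDerivAt z (y t) t)
    (τ : ℝ) (hz0 : z 0 = 0) (hzτ : z τ = 0) :
    τ = y 0 - y τ ∧ Real.exp (c * τ) * (c * y 0 - 1) = c * y τ - 1 := by
  constructor
  · have hconst : ∀ t, HasDerivAt (fun s => y s - c * z s + s) 0 t := fun t =>
      (((hy t).sub ((hz t).const_mul c)).add (hasDerivAt_id t)).congr_deriv (by ring)
    have h := eq_of_hasDerivAt_zero hconst τ 0
    simp only [hz0, hzτ] at h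
    linarith
  · have hconst : ∀ t, HasDerivAt (fun s => Real.exp (-(c * s)) * (c * y s - 1)) 0 t := fun t =>
      ((((hasDerivAt_id t).const_mul c).neg.exp).mul
        (((hy t).const_mul c).sub_const 1)).congr_deriv (by simp; ring)
    have h := eq_of_hasDerivAt_zero hconst 0 τ
    simp only [mul_zero, neg_zero, Real.exp_zero, one_mul] at h
    rw [h, ← mul_assoc, ← Real.exp_add, add_neg_cancel, Real.exp_zero, one_mul]
end
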